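/- For every positive integer n, the number of pairs (x,y) of integers with x² + y² = n equals 4 · Σ_{d | n} χ(d), where χ is the unique primitive Dirichlet character modulo 4 (i.e., χ(d) = 1 if d ≡ 1 mod 4, χ(d) = −1 if d ≡ 3 mod 4, and χ(d) = 0 if d is even). -/

import Mathlib

/-- The representations of `m` as an ordered sum of two integer squares. -/
def sqAddSqReps (m : ℤ) : Set (ℤ × ℤ) := {q | q.1 ^ 2 + q.2 ^ 2 = m}

theorem mem_sqAddSqReps {m : ℤ} {q : ℤ × ℤ} : q ∈ sqAddSqReps m ↔ q.1 ^ 2 + q.2 ^ 2 = m := Iff.rfl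

theorem finite_sqAddSqReps (m : ℤ) : (sqAddSqReps m).Finite := by
  refine ((Set.finite_Icc (-m) m).prod (Set.finite_Icc (-m) m)).subset ?_
  rintro ⟨x, y⟩ h
  simp only [mem_sqAddSqReps] at h
  have hx := Int.le_self_sq x
  have hx' := Int.le_self_sq (-x)
  have hy := Int.le_self_sq y
  have hy' := Int.le_self_sq (-y)
  simp only [Set.mem_prod, Set.mem_Icc]
  refine ⟨⟨?_, ?_⟩, ?_, ?_⟩ <;> nlinarith [sq_nonneg x, sq_nonneg y]

theorem ncard_sqAddSqReps_one : (sqAddSqReps 1).ncard = 4 := by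
  have h : sqAddSqReps 1 = (({(1, 0), (-1, 0), (0, 1), (0, -1)} : Finset (ℤ × ℤ)) : Set (ℤ × ℤ)) := by
    ext ⟨x, y⟩
    simp only [mem_sqAddSqReps, Finset.coe_insert, Finset.coe_singleton, Set.mem_insert_iff,
      Set.mem_singleton_iff, Prod.mk.injEq]
    constructor
    · intro h
      have hx : x ≤ 1 := by nlinarith [sq_nonneg y]
      have hx' : -1 ≤ x := by nlinarith [sq_nonneg y]
      have hy : y ≤ 1 := by nlinarith [sq_nonneg x]
      have hy' : -1 ≤ y := by nlinarith [sq_nonneg x]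
      interval_cases x <;> interval_cases y <;> simp_all
    · rintro (⟨rfl, rfl⟩ | ⟨rfl, rfl⟩ | ⟨rfl, rfl⟩ | ⟨rfl, rfl⟩) <;> norm_num
  rw [h, Set.ncard_coe_finset]
  rfl

/-- Multiplication by the Gaussian integer `a + b i`, in coordinates. -/
def gaussMul (a b : ℤ) (q : ℤ × ℤ) : ℤ × ℤ := (a * q.1 - b * q.2, a * q.2 + b * q.1)

theorem gaussMul_injective {a b : ℤ} (h : a ^ 2 + b ^ 2 ≠ 0) :
    Function.Injective (gaussMul a b) := by
  rintro ⟨x, y⟩ ⟨u, v⟩ e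
  simp only [gaussMul, Prod.mk.injEq] at e ⊢
  obtain ⟨e₁, e₂⟩ := e
  exact ⟨mul_left_cancel₀ h (by linear_combination a * e₁ + b * e₂),
    mul_left_cancel₀ h (by linear_combination a * e₂ - b * e₁)⟩

theorem image_gaussMul_sqAddSqReps {p a b : ℤ} (hp : Prime p) (h : a ^ 2 + b ^ 2 = p) (m : ℤ) :
    gaussMul a b '' sqAddSqReps m = {q ∈ sqAddSqReps (p * m) | p ∣ a * q.2 - b * q.1} := by
  ext ⟨x, y⟩
  simp only [Set.mem_image, Set.mem_ofPred_eq, mem_sqAddSqReps, gaussMul, Prod.mk.injEq, Prod.exists]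
  constructor
  · rintro ⟨u, v, huv, rfl, rfl⟩
    exact ⟨by rw [← h, ← huv]; ring, v, by rw [← h]; ring⟩
  · rintro ⟨hxy, v, hv⟩
    have hd : p ∣ (a * x + b * y) ^ 2 :=
      ⟨p * m - p * v ^ 2, by
        linear_combination (a ^ 2 + b ^ 2) * hxy + p * m * h - (a * y - b * x + p * v) * hv⟩
    obtain ⟨u, hu⟩ := hp.dvd_of_dvd_pow hd
    have hx : a * u - b * v = x := mul_left_cancel₀ hp.ne_zero (by
      linear_combination x * h - a * hu + b * hv)
    have hy : a * v + b * u = y := mul_left_cancel₀ hp.ne_zero (by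
      linear_combination y * h - a * hv - b * hu)
    refine ⟨u, v, mul_left_cancel₀ hp.ne_zero ?_, hx, hy⟩
    rw [← hxy, ← hx, ← hy, ← h]
    ring

theorem not_dvd_of_sq_add_sq_eq {p a b : ℤ} (hp : Prime p) (h : a ^ 2 + b ^ 2 = p) : ¬ p ∣ a := by
  rintro ⟨c, rfl⟩
  have hb : p ∣ b := hp.dvd_of_dvd_pow (n := 2) ⟨1 - p * c ^ 2, by linear_combination h⟩
  obtain ⟨d, rfl⟩ := hb
  refine hp.not_dvd_one ⟨c ^ 2 + d ^ 2, mul_left_cancel₀ hp.ne_zero ?_⟩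
  linear_combination -h

theorem ncard_sqAddSqReps_two_mul (m : ℤ) :
    (sqAddSqReps (2 * m)).ncard = (sqAddSqReps m).ncard := by
  rw [← Set.ncard_image_of_injective (sqAddSqReps m)
    (gaussMul_injective (a := 1) (b := 1) (by norm_num)),
    image_gaussMul_sqAddSqReps Int.prime_two (by norm_num)]
  congr 1
  ext ⟨x, y⟩
  simp only [Set.mem_ofPred_eq, iff_self_and, mem_sqAddSqReps]
  intro h
  have h2 : (2 : ℤ) ∣ (1 * y - 1 * x) ^ 2 := ⟨m - x * y, by linear_combination h⟩
  exact Int.prime_two.dvd_of_dvd_pow h2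

/-- The representations of `p * m` with both coordinates divisible by `p` correspond to the
representations of `m / p`. -/
theorem ncard_sqAddSqReps_dvd {p : ℤ} (hp : p ≠ 0) (m : ℤ) :
    {q ∈ sqAddSqReps (p * m) | p ∣ q.1 ∧ p ∣ q.2}.ncard =
      if p ∣ m then (sqAddSqReps (m / p)).ncard else 0 := by
  split_ifs with h
  · obtain ⟨k, rfl⟩ := h
    rw [Int.mul_ediv_cancel_left _ hp]
    have hinj : Function.Injective (fun q : ℤ × ℤ ↦ (p * q.1, p * q.2)) := by
      rintro ⟨x, y⟩ ⟨u, v⟩ e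
      simpa [hp] using e
    rw [← Set.ncard_image_of_injective (sqAddSqReps k) hinj]
    congr 1
    ext ⟨x, y⟩
    simp only [Set.mem_image, Set.mem_ofPred_eq, mem_sqAddSqReps, Prod.mk.injEq, Prod.exists]
    constructor
    · rintro ⟨e, ⟨u, rfl⟩, v, rfl⟩
      refine ⟨u, v, mul_left_cancel₀ hp (mul_left_cancel₀ hp ?_), rfl, rfl⟩
      linear_combination e
    · rintro ⟨u, v, e, rfl, rfl⟩
      exact ⟨by rw [← e]; ring, dvd_mul_right _ _, dvd_mul_right _ _⟩
  · rw [Set.ncard_eq_zero ((finite_sqAddSqReps _).subset (Set.sep_subset _ _)),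
      Set.eq_empty_iff_forall_notMem]
    rintro ⟨x, y⟩ ⟨e, ⟨u, hu⟩, v, hv⟩
    simp only [mem_sqAddSqReps] at e hu hv
    subst hu hv
    exact h ⟨u ^ 2 + v ^ 2, mul_left_cancel₀ hp (by linear_combination -e)⟩

theorem ncard_sqAddSqReps_mul_of_sq_add_sq {p a b : ℤ} (hp : Prime p) (hp2 : ¬ p ∣ 2)
    (h : a ^ 2 + b ^ 2 = p) (m : ℤ) :
    (sqAddSqReps (p * m)).ncard + (if p ∣ m then (sqAddSqReps (m / p)).ncard else 0) =
      2 * (sqAddSqReps m).ncard := by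
  have h' : a ^ 2 + (-b) ^ 2 = p := by rw [neg_sq, h]
  have ha : ¬ p ∣ a := not_dvd_of_sq_add_sq_eq hp h
  have hb : ¬ p ∣ b := not_dvd_of_sq_add_sq_eq hp (by rw [add_comm, h])
  have hA := Set.ncard_image_of_injective (sqAddSqReps m)
    (gaussMul_injective (h.trans_ne hp.ne_zero))
  have hB := Set.ncard_image_of_injective (sqAddSqReps m)
    (gaussMul_injective (h'.trans_ne hp.ne_zero))
  rw [image_gaussMul_sqAddSqReps hp h] at hA
  rw [image_gaussMul_sqAddSqReps hp h'] at hB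
  rw [← ncard_sqAddSqReps_dvd hp.ne_zero]
  have key := Set.ncard_union_add_ncard_inter
    {q ∈ sqAddSqReps (p * m) | p ∣ a * q.2 - b * q.1}
    {q ∈ sqAddSqReps (p * m) | p ∣ a * q.2 - -b * q.1}
    ((finite_sqAddSqReps _).subset (Set.sep_subset _ _))
    ((finite_sqAddSqReps _).subset (Set.sep_subset _ _))
  rw [hA, hB, ← two_mul] at key
  rw [← key]
  congr 2
  · ext ⟨x, y⟩
    simp only [Set.mem_union, Set.mem_ofPred_eq, ← and_or_left, iff_self_and, mem_sqAddSqReps]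
    intro e
    refine hp.dvd_or_dvd ⟨a ^ 2 * m - x ^ 2, ?_⟩
    linear_combination a ^ 2 * e - x ^ 2 * h
  · ext ⟨x, y⟩
    simp only [Set.mem_inter_iff, Set.mem_ofPred_eq, ← and_and_left]
    refine and_congr_right fun _ ↦ ⟨?_, ?_⟩
    · rintro ⟨hx, hy⟩
      exact ⟨(hy.mul_left a).sub (hx.mul_left b), (hy.mul_left a).sub (hx.mul_left (-b))⟩
    · rintro ⟨⟨u, hu⟩, v, hv⟩
      have hx : p ∣ 2 * (b * x) := ⟨v - u, by linear_combination hv - hu⟩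
      have hy : p ∣ 2 * (a * y) := ⟨u + v, by linear_combination hu + hv⟩
      exact ⟨((hp.dvd_or_dvd ((hp.dvd_or_dvd hx).resolve_left hp2)).resolve_left hb),
        ((hp.dvd_or_dvd ((hp.dvd_or_dvd hy).resolve_left hp2)).resolve_left ha)⟩

theorem dvd_and_dvd_of_dvd_sq_add_sq {p : ℕ} [Fact p.Prime] (hp : p % 4 = 3) {x y : ℤ}
    (h : (p : ℤ) ∣ x ^ 2 + y ^ 2) : (p : ℤ) ∣ x ∧ (p : ℤ) ∣ y := by
  have hpp : Prime (p : ℤ) := Nat.prime_iff_prime_int.mp Fact.out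
  have hx : (p : ℤ) ∣ x := by
    by_contra hx
    rw [← ZMod.intCast_zmod_eq_zero_iff_dvd] at hx h
    push_cast at h
    exact ZMod.mod_four_ne_three_of_sq_eq_neg_sq' hx (x := (y : ZMod p))
      (by linear_combination h) hp
  exact ⟨hx, hpp.dvd_of_dvd_pow ((dvd_add_right (hx.pow two_ne_zero)).mp h)⟩

theorem ncard_sqAddSqReps_prime_mul {p : ℕ} (hp : p.Prime) (m : ℕ) :
    ((sqAddSqReps (p * m : ℕ)).ncard : ℤ) +
        ZMod.χ₄ p * (if p ∣ m then ((sqAddSqReps (m / p : ℕ)).ncard : ℤ) else 0) =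
      (1 + ZMod.χ₄ p) * (sqAddSqReps m).ncard := by
  have : Fact p.Prime := ⟨hp⟩
  have hpp : Prime (p : ℤ) := Nat.prime_iff_prime_int.mp hp
  have hcast : (if p ∣ m then ((sqAddSqReps (m / p : ℕ)).ncard : ℤ) else 0) =
      ((if (p : ℤ) ∣ m then (sqAddSqReps ((m : ℤ) / p)).ncard else 0 : ℕ) : ℤ) := by
    simp [Int.natCast_dvd_natCast]
  rw [hcast, Nat.cast_mul]
  rcases hp.eq_two_or_odd with rfl | hodd
  · have := ncard_sqAddSqReps_two_mul m
    simp [this]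
  · rcases (by lia : p % 4 = 1 ∨ p % 4 = 3) with h | h
    · obtain ⟨a, b, hab⟩ := Nat.Prime.sq_add_sq (p := p) (by lia)
      have hp2 : ¬ (p : ℤ) ∣ 2 := by
        intro hd
        have := Nat.le_of_dvd two_pos (by exact_mod_cast hd)
        have := hp.two_le
        lia
      have := ncard_sqAddSqReps_mul_of_sq_add_sq hpp hp2 (a := a) (b := b) (by exact_mod_cast hab) m
      rw [ZMod.χ₄_nat_one_mod_four h]
      zify at this
      push_cast
      linarith
    · rw [ZMod.χ₄_nat_three_mod_four h, ← ncard_sqAddSqReps_dvd hpp.ne_zero]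
      have : {q ∈ sqAddSqReps ((p : ℤ) * m) | (p : ℤ) ∣ q.1 ∧ (p : ℤ) ∣ q.2} =
          sqAddSqReps ((p : ℤ) * m) := by
        refine Set.sep_eq_self_iff_mem_true.mpr fun q hq ↦ ?_
        exact dvd_and_dvd_of_dvd_sq_add_sq h ⟨m, hq⟩
      rw [this]
      ring

theorem sum_divisors_prime_mul {R : Type*} [CommRing R] (f : ℕ →* R) {p m : ℕ} (hp : p.Prime)
    (hm : m ≠ 0) :
    ∑ d ∈ (p * m).divisors, f d + f p * (if p ∣ m then ∑ d ∈ (m / p).divisors, f d else 0) =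
      (1 + f p) * ∑ d ∈ m.divisors, f d := by
  have hinj : Function.Injective (p * ·) := mul_right_injective₀ hp.ne_zero
  have hsum (s : Finset ℕ) : ∑ d ∈ s.image (p * ·), f d = f p * ∑ d ∈ s, f d := by
    rw [Finset.sum_image hinj.injOn, Finset.mul_sum]
    exact Finset.sum_congr rfl fun d _ ↦ map_mul f p d
  have hunion : m.divisors ∪ m.divisors.image (p * ·) = (p * m).divisors := by
    ext d
    simp only [Finset.mem_union, Finset.mem_image, Nat.mem_divisors, ne_eq, hm, hp.ne_zero,
      mul_eq_zero, not_false_eq_true, and_true, or_self]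
    constructor
    · rintro (h | ⟨e, he, rfl⟩)
      · exact h.mul_left p
      · exact mul_dvd_mul_left p he
    · intro h
      by_cases hd : p ∣ d
      · obtain ⟨e, rfl⟩ := hd
        exact .inr ⟨e, Nat.dvd_of_mul_dvd_mul_left hp.pos h, rfl⟩
      · exact .inl (((hp.coprime_iff_not_dvd.mpr hd).symm).dvd_of_dvd_mul_left h)
  have hinter : ∑ d ∈ m.divisors ∩ m.divisors.image (p * ·), f d =
      f p * (if p ∣ m then ∑ d ∈ (m / p).divisors, f d else 0) := by
    split_ifs with h
    · obtain ⟨k, rfl⟩ := h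
      rw [Nat.mul_div_cancel_left _ hp.pos, ← hsum]
      congr 1
      ext d
      have hk : k ≠ 0 := right_ne_zero_of_mul hm
      simp only [Finset.mem_inter, Finset.mem_image, Nat.mem_divisors, ne_eq, hm, hk,
        not_false_eq_true, and_true]
      constructor
      · rintro ⟨h, e, -, rfl⟩
        exact ⟨e, Nat.dvd_of_mul_dvd_mul_left hp.pos h, rfl⟩
      · rintro ⟨e, he, rfl⟩
        exact ⟨mul_dvd_mul_left p he, e, he.mul_left p, rfl⟩
    · rw [mul_zero, Finset.sum_eq_zero]
      intro d hd
      simp only [Finset.mem_inter, Finset.mem_image, Nat.mem_divisors] at hd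
      obtain ⟨⟨h₁, -⟩, e, -, rfl⟩ := hd
      exact absurd ((dvd_mul_right p e).trans h₁) h
  rw [← hunion, ← hinter, Finset.sum_union_inter, hsum]
  ring

theorem ncard_sqAddSqReps_eq_sum_χ₄ (n : ℕ) (hn : n ≠ 0) :
    ((sqAddSqReps n).ncard : ℤ) = 4 * ∑ d ∈ n.divisors, ZMod.χ₄ d := by
  induction n using Nat.strong_induction_on with
  | _ n ih =>
  rcases eq_or_ne n 1 with rfl | h1
  · simp [ncard_sqAddSqReps_one]
  obtain ⟨p, hp, m, rfl⟩ := Nat.exists_prime_and_dvd h1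
  have hm : m ≠ 0 := right_ne_zero_of_mul hn
  have hlt : m < p * m := lt_mul_of_one_lt_left (Nat.pos_of_ne_zero hm) hp.one_lt
  have hr := ncard_sqAddSqReps_prime_mul hp m
  have hs := sum_divisors_prime_mul
    ((ZMod.χ₄ : ZMod 4 →* ℤ).comp (Nat.castRingHom (ZMod 4) : ℕ →* ZMod 4)) hp hm
  simp only [MonoidHom.comp_apply, MonoidHom.coe_coe, Nat.coe_castRingHom] at hs
  rw [ih m hlt hm] at hr
  split_ifs at hr hs with h
  · rw [ih (m / p) ((Nat.div_le_self m p).trans_lt hlt)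
      (Nat.div_pos (Nat.le_of_dvd (Nat.pos_of_ne_zero hm) h) hp.pos).ne'] at hr
    linear_combination hr - 4 * hs
  · linear_combination hr - 4 * hs

theorem sum_two_squares_count (n : ℕ) (hn : 0 < n) :
    (Nat.card {p : ℤ × ℤ // p.1 ^ 2 + p.2 ^ 2 = (n : ℤ)} : ℤ) =
      4 * ∑ d ∈ n.divisors,
        (if d % 4 = 1 then (1 : ℤ) else if d % 4 = 3 then -1 else 0) := by
  refine (ncard_sqAddSqReps_eq_sum_χ₄ n hn.ne').trans ?_
  congr 1
  refine Finset.sum_congr rfl fun d _ ↦ ?_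
  rw [ZMod.χ₄_nat_eq_if_mod_four]
  split_ifs <;> first | rfl | lia
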